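/- For π ∈ Π_n, let Δ_π ⊆ ℝⁿ be the convex hull of the indicator vectors e_B = Σ_{i ∈ B} e_i over all bases B of the matroid M_π, where e_1, …, e_n is the standard basis of ℝⁿ. Then the affine dimension of Δ_π (the rank of the direction of its affine span) equals w(π) − 2 if ℓ(π) = 2, and equals w(π) − 1 if ℓ(π) ≥ 3. -/

import Mathlib

/-- `I` is a partial 2-transversal of the family `F`. -/
def IsTransversal2 {α : Type*} (F : Set (Set α)) (I : Set α) : Prop :=
  ∃ P ∈ F, ∃ Q ∈ F, P ≠ Q ∧ ∃ i ∈ P, ∃ j ∈ Q, I = {i, j}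

/-- A partial partition of `n`. -/
def PartialPartition (n : ℕ) (π : Multiset ℕ) : Prop :=
  (∀ k ∈ π, 0 < k) ∧ 2 ≤ Multiset.card π ∧ π.sum ≤ n

/-- The canonical set partition of `{1, …, w(π)}` associated to a partial partition `π`. -/
def canonicalParts (π : Multiset ℕ) : Set (Set ℕ) :=
  {S | ∃ i < (π.sort (· ≤ ·)).length,
    S = Set.Ioc (((π.sort (· ≤ ·)).take i).sum) (((π.sort (· ≤ ·)).take (i + 1)).sum)}

/-- The bases of the canonical matroid `M_π` on `{1, …, n}`. -/
def MpiBase (π : Multiset ℕ) (B : Set ℕ) : Prop :=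
  IsTransversal2 (canonicalParts π) B

open Classical in
/-- The indicator vector `e_B ∈ ℝⁿ` of a subset `B ⊆ {1, …, n}`, where the coordinate
indexed by `i : Fin n` corresponds to the ground set element `i + 1`. -/
noncomputable def indVec (n : ℕ) (B : Set ℕ) : Fin n → ℝ :=
  fun i => if ((i : ℕ) + 1) ∈ B then 1 else 0

/-- The matroid polytope `Δ_π ⊆ ℝⁿ`: the convex hull of the indicator vectors of the
bases of `M_π`. -/
noncomputable def matroidPolytope (n : ℕ) (π : Multiset ℕ) : Set (Fin n → ℝ) :=
  convexHull ℝ {v | ∃ B, MpiBase π B ∧ v = indVec n B}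

theorem indVec_pair (n : ℕ) {a b : ℕ} (h : a ≠ b) :
    indVec n {a, b} = indVec n {a} + indVec n {b} := by
  funext i
  simp only [indVec, Set.mem_insert_iff, Set.mem_singleton_iff, Pi.add_apply]
  grind

/-- The vectors `e_a - e_{r a}` are linearly independent when `r` maps the index set off itself. -/
theorem linearIndependent_indVec_sub {n : ℕ} {T : Finset ℕ} (hT : ∀ a ∈ T, 0 < a ∧ a ≤ n)
    (r : ℕ → ℕ) (hr : ∀ a ∈ T, r a ∉ T) :
    LinearIndependent ℝ (fun a : T => indVec n {a.1} - indVec n {r a.1}) := by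
  classical
  rw [Fintype.linearIndependent_iff]
  intro g hg a
  obtain ⟨ha, han⟩ := hT a a.2
  have h := congrFun hg ⟨a.1 - 1, by omega⟩
  have h1 : a.1 - 1 + 1 = a.1 := by omega
  simp only [Finset.sum_apply, Pi.smul_apply, Pi.sub_apply, indVec, Set.mem_singleton_iff,
    smul_eq_mul, Pi.zero_apply, h1] at h
  rw [Finset.sum_eq_single a] at h
  · have h2 : a.1 ≠ r a.1 := fun e => hr a a.2 (e ▸ a.2)
    simpa [h2] using h
  · intro b _ hb
    have h2 : a.1 ≠ r b.1 := fun e => hr b b.2 (e ▸ a.2)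
    have h3 : a.1 ≠ b.1 := fun e => hb (Subtype.ext e.symm)
    simp [h2, h3]
  · simp

/-- If every vector of `S` is some `e_a + e_b` whose image under a retraction `r` of the index set
is constant, and all `e_a - e_{r a}` are directions of `S`, then the affine dimension of `S` is the
number of indices moved by `r`. -/
theorem finrank_vectorSpan_of_retraction {n : ℕ} {S : Set (Fin n → ℝ)} {D : Finset ℕ}
    (hD : ∀ a ∈ D, 0 < a ∧ a ≤ n) (r : ℕ → ℕ) (hr : ∀ a ∈ D, r (r a) = r a)
    (u : Fin n → ℝ)
    (hS : ∀ v ∈ S, ∃ a ∈ D, ∃ b ∈ D, v = indVec n {a} + indVec n {b} ∧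
      indVec n {r a} + indVec n {r b} = u)
    (hdir : ∀ a ∈ D, indVec n {a} - indVec n {r a} ∈ vectorSpan ℝ S) :
    Module.finrank ℝ (vectorSpan ℝ S) = {a ∈ D | r a ≠ a}.card := by
  set T := {a ∈ D | r a ≠ a} with hT
  set f : T → (Fin n → ℝ) := fun a => indVec n {a.1} - indVec n {r a.1} with hf
  have hmem : ∀ a ∈ D, indVec n {a} - indVec n {r a} ∈ Submodule.span ℝ (Set.range f) := by
    intro a ha
    by_cases h : r a = a
    · simp [h]
    · exact Submodule.subset_span ⟨⟨a, by simp [hT, ha, h]⟩, rfl⟩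
  have hspan : vectorSpan ℝ S = Submodule.span ℝ (Set.range f) := by
    apply le_antisymm
    · refine Submodule.span_le.2 ?_
      rintro _ ⟨v, hv, v', hv', rfl⟩
      obtain ⟨a, ha, b, hb, rfl, h⟩ := hS v hv
      obtain ⟨c, hc, d, hd, rfl, h'⟩ := hS v' hv'
      have key := sub_mem (add_mem (hmem a ha) (hmem b hb)) (add_mem (hmem c hc) (hmem d hd))
      have e : indVec n {a} + indVec n {b} - (indVec n {c} + indVec n {d}) =
          indVec n {a} - indVec n {r a} + (indVec n {b} - indVec n {r b}) -
            (indVec n {c} - indVec n {r c} + (indVec n {d} - indVec n {r d})) := by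
        linear_combination h - h'
      rw [← e] at key
      exact key
    · refine Submodule.span_le.2 ?_
      rintro _ ⟨a, rfl⟩
      exact hdir a (Finset.mem_filter.1 a.2).1
  have hli : LinearIndependent ℝ f :=
    linearIndependent_indVec_sub (fun a ha => hD a (Finset.mem_filter.1 ha).1) r
      (fun a ha h => (Finset.mem_filter.1 h).2 (hr a (Finset.mem_filter.1 ha).1))
  rw [hspan, finrank_span_eq_card hli, Fintype.card_coe]

theorem vectorSpan_convexHull_eq {E : Type*} [AddCommGroup E] [Module ℝ E] (S : Set E) :
    vectorSpan ℝ (convexHull ℝ S) = vectorSpan ℝ S := by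
  rw [← direction_affineSpan, affineSpan_convexHull, direction_affineSpan]

theorem List.exists_mem_Ioc_take_sum (L : List ℕ) {m : ℕ} (h0 : 0 < m) (hm : m ≤ L.sum) :
    ∃ i < L.length, m ∈ Set.Ioc (L.take i).sum (L.take (i + 1)).sum := by
  induction L generalizing m with
  | nil => simp at hm; omega
  | cons k L ih =>
    by_cases h : m ≤ k
    · exact ⟨0, by simp, by simpa using ⟨h0, h⟩⟩
    · obtain ⟨i, hi, h1, h2⟩ := ih (m := m - k) (by omega) (by simp at hm; omega)
      refine ⟨i + 1, by simpa using hi, ?_⟩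
      simp only [List.take_succ_cons, List.sum_cons, Set.mem_Ioc]
      omega

theorem List.sum_take_lt_sum_take_succ {L : List ℕ} (hL : ∀ k ∈ L, 0 < k) {i : ℕ}
    (hi : i < L.length) : (L.take i).sum < (L.take (i + 1)).sum := by
  rw [List.sum_take_succ L i hi]
  have := hL _ (List.getElem_mem hi)
  omega

theorem List.eq_of_mem_Ioc_take_sum (L : List ℕ) {m i j : ℕ}
    (hi : m ∈ Set.Ioc (L.take i).sum (L.take (i + 1)).sum)
    (hj : m ∈ Set.Ioc (L.take j).sum (L.take (j + 1)).sum) : i = j := by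
  have hmono : Monotone fun i => (L.take i).sum := fun a b hab =>
    (List.take_sublist_take_left hab).sum_le_sum (by simp)
  simp only [Set.mem_Ioc] at hi hj
  rcases lt_trichotomy i j with h | h | h
  · have := hmono (Nat.succ_le_of_lt h)
    simp only [Nat.succ_eq_add_one] at this
    omega
  · exact h
  · have := hmono (Nat.succ_le_of_lt h)
    simp only [Nat.succ_eq_add_one] at this
    omega

/-- Bases of `M_π` in terms of the sorted list of parts. -/
theorem mpiBase_iff {π : Multiset ℕ} (hpos : ∀ k ∈ π, 0 < k) {L : List ℕ}
    (hL : L = π.sort (· ≤ ·)) (B : Set ℕ) :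
    MpiBase π B ↔ ∃ i < L.length, ∃ j < L.length, i ≠ j ∧
      ∃ a ∈ Set.Ioc (L.take i).sum (L.take (i + 1)).sum,
      ∃ b ∈ Set.Ioc (L.take j).sum (L.take (j + 1)).sum, B = {a, b} := by
  subst hL
  constructor
  · rintro ⟨_, ⟨i, hi, rfl⟩, _, ⟨j, hj, rfl⟩, hne, h⟩
    exact ⟨i, hi, j, hj, fun e => hne (by rw [e]), h⟩
  · rintro ⟨i, hi, j, hj, hne, h⟩
    refine ⟨_, ⟨i, hi, rfl⟩, _, ⟨j, hj, rfl⟩, fun e => hne ?_, h⟩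
    have hi' := List.sum_take_lt_sum_take_succ (L := π.sort (· ≤ ·))
      (fun k hk => hpos k (by simpa using hk)) hi
    have hmem := Set.right_mem_Ioc.2 hi'
    exact List.eq_of_mem_Ioc_take_sum _ hmem (e ▸ hmem)

/-- the affine dimension of `Δ_π` is `w(π) − 2` if `ℓ(π) = 2` and
`w(π) − 1` if `ℓ(π) ≥ 3`. -/
theorem stmt_7 (n : ℕ) (π : Multiset ℕ) (hπ : PartialPartition n π) :
    (Multiset.card π = 2 →
      Module.finrank ℝ (vectorSpan ℝ (matroidPolytope n π)) = π.sum - 2) ∧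
    (3 ≤ Multiset.card π →
      Module.finrank ℝ (vectorSpan ℝ (matroidPolytope n π)) = π.sum - 1) := by
  obtain ⟨hpos, -, hn⟩ := hπ
  obtain ⟨L, hL⟩ : ∃ L, L = π.sort (· ≤ ·) := ⟨_, rfl⟩
  have hlen : L.length = Multiset.card π := by rw [hL, Multiset.length_sort]
  have hsum : L.sum = π.sum := by
    rw [← Multiset.sum_coe, hL, Multiset.sort_eq]
  have hLpos : ∀ k ∈ L, 0 < k := fun k hk => hpos k (by simpa [hL] using hk)
  have hle : ∀ i, (L.take i).sum ≤ L.sum := fun i => (List.take_sublist i L).sum_le_sum (by simp)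
  unfold matroidPolytope
  rw [vectorSpan_convexHull_eq, ← hsum, ← hlen]
  rw [← hsum] at hn
  set S := {v | ∃ B, MpiBase π B ∧ v = indVec n B} with hS
  have hD : ∀ a ∈ Finset.Icc 1 L.sum, 0 < a ∧ a ≤ n := fun a ha => by
    rw [Finset.mem_Icc] at ha; omega
  have hdec : ∀ v ∈ S, ∃ i < L.length, ∃ j < L.length, i ≠ j ∧
      ∃ a ∈ Set.Ioc (L.take i).sum (L.take (i + 1)).sum,
      ∃ b ∈ Set.Ioc (L.take j).sum (L.take (j + 1)).sum,
        v = indVec n {a} + indVec n {b} := by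
    rintro _ ⟨B, hB, rfl⟩
    obtain ⟨i, hi, j, hj, hij, a, ha, b, hb, rfl⟩ := (mpiBase_iff hpos hL B).1 hB
    refine ⟨i, hi, j, hj, hij, a, ha, b, hb, indVec_pair n ?_⟩
    rintro rfl
    exact hij (List.eq_of_mem_Ioc_take_sum L ha hb)
  have hbase : ∀ i < L.length, ∀ j < L.length, i ≠ j →
      ∀ a ∈ Set.Ioc (L.take i).sum (L.take (i + 1)).sum,
      ∀ b ∈ Set.Ioc (L.take j).sum (L.take (j + 1)).sum,
        indVec n {a} + indVec n {b} ∈ S := by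
    intro i hi j hj hij a ha b hb
    refine ⟨{a, b}, (mpiBase_iff hpos hL _).2 ⟨i, hi, j, hj, hij, a, ha, b, hb, rfl⟩,
      (indVec_pair n ?_).symm⟩
    rintro rfl
    exact hij (List.eq_of_mem_Ioc_take_sum L ha hb)
  have hdir : ∀ i < L.length, ∀ j < L.length, ∀ l < L.length, i ≠ l → j ≠ l →
      ∀ a ∈ Set.Ioc (L.take i).sum (L.take (i + 1)).sum,
      ∀ b ∈ Set.Ioc (L.take j).sum (L.take (j + 1)).sum,
        indVec n {a} - indVec n {b} ∈ vectorSpan ℝ S := by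
    intro i hi j hj l hl hil hjl a ha b hb
    have hd := Set.right_mem_Ioc.2 (List.sum_take_lt_sum_take_succ hLpos hl)
    have := vsub_mem_vectorSpan ℝ (hbase i hi l hl hil a ha _ hd) (hbase j hj l hl hjl b hb _ hd)
    rwa [vsub_eq_sub, add_sub_add_right_eq_sub] at this
  constructor
  · intro h2
    obtain ⟨k, k', rfl⟩ := List.length_eq_two.1 h2
    have hk : 0 < k := hLpos k (by simp)
    have hk' : 0 < k' := hLpos k' (by simp)
    clear_value S
    simp only [List.sum_cons, List.sum_nil, add_zero, List.length_cons, List.length_nil, zero_add,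
      Nat.reduceAdd] at *
    rw [finrank_vectorSpan_of_retraction hD (fun a => if a ≤ k then 1 else k + 1)
      (fun a _ => by grind) (indVec n {1} + indVec n {k + 1})]
    · have : {a ∈ Finset.Icc 1 (k + k') | (if a ≤ k then 1 else k + 1) ≠ a} =
          (Finset.Icc 1 (k + k')) \ {1, k + 1} := by
        ext a
        simp only [Finset.mem_filter, Finset.mem_sdiff, Finset.mem_Icc, Finset.mem_insert,
          Finset.mem_singleton]
        grind
      rw [this, Finset.card_sdiff_of_subset, Nat.card_Icc, Finset.card_pair (by omega)]
      · omega
      · intro a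
        simp only [Finset.mem_insert, Finset.mem_singleton, Finset.mem_Icc]
        omega
    · intro v hv
      obtain ⟨i, hi, j, hj, hij, a, ha, b, hb, rfl⟩ := hdec v hv
      refine ⟨a, ?_, b, ?_, rfl, ?_⟩
      all_goals
        obtain ⟨rfl, rfl⟩ | ⟨rfl, rfl⟩ : i = 0 ∧ j = 1 ∨ i = 1 ∧ j = 0 := by omega
      all_goals
        simp only [List.take_zero, List.sum_nil, zero_add, List.take_succ_cons, List.sum_cons,
          add_zero, Set.mem_Ioc, Nat.reduceAdd] at ha hb
      all_goals try (rw [Finset.mem_Icc]; omega)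
      · rw [if_pos ha.2, if_neg (by omega)]
      · rw [if_neg (by omega), if_pos hb.2, add_comm]
    · intro a ha
      rw [Finset.mem_Icc] at ha
      split_ifs with h
      · exact hdir 0 (by simp) 0 (by simp) 1 (by simp) (by simp) (by simp) a
          (by simp; omega) 1 (by simp; omega)
      · exact hdir 1 (by simp) 1 (by simp) 0 (by simp) (by simp) (by simp) a
          (by simp; omega) (k + 1) (by simp; omega)
  · intro h3
    have hw : 1 ≤ L.sum := by
      have := List.sum_take_lt_sum_take_succ hLpos (i := 0) (by omega)
      have := hle (0 + 1)
      omega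
    rw [finrank_vectorSpan_of_retraction hD (fun _ => 1) (fun _ _ => rfl)
      (indVec n {1} + indVec n {1})]
    · have : {a ∈ Finset.Icc 1 L.sum | 1 ≠ a} = (Finset.Icc 1 L.sum).erase 1 := by
        ext a
        simp only [Finset.mem_filter, Finset.mem_erase]
        tauto
      rw [this, Finset.card_erase_of_mem (by simpa using hw), Nat.card_Icc]
      omega
    · intro v hv
      obtain ⟨i, _, j, _, _, a, ha, b, hb, rfl⟩ := hdec v hv
      have hi := hle (i + 1)
      have hj := hle (j + 1)
      rw [Set.mem_Ioc] at ha hb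
      exact ⟨a, by rw [Finset.mem_Icc]; omega, b, by rw [Finset.mem_Icc]; omega, rfl, rfl⟩
    · intro a ha
      rw [Finset.mem_Icc] at ha
      obtain ⟨i, hi, hai⟩ := L.exists_mem_Ioc_take_sum ha.1 ha.2
      obtain ⟨j, hj, hbj⟩ := L.exists_mem_Ioc_take_sum one_pos hw
      obtain ⟨l, hl, hil, hjl⟩ : ∃ l < 3, i ≠ l ∧ j ≠ l := by
        by_contra! h
        have := h 0
        have := h 1
        have := h 2
        omega
      exact hdir i hi j hj l (by omega) hil hjl a hai 1 hbj
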